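/- (Normalizer criterion for the n-tuple point.) Let h = Σ_{i=0}^{n−1} h_i *_λ x^i with h₀,…,h_{n−1} ∈ ℝ[p]. Then x^n *_λ h lies in J_l := {g *_λ x^n : g ∈ ℝ[x,p]} if and only if the polynomials h_i satisfy the system of differential equations Σ_{i=0}^{l} C(n, l−i) (2λ)^{n−l+i} d^{n−l+i}h_i/dp^{n−l+i} = 0 for every l = 0, 1, …, n−1. -/

import Mathlib

/- The Moyal product on ℝ[x,p], where x = X 0 and p = X 1 in `MvPolynomial (Fin 2) ℝ`:
   f *_λ g := Σ_{i=0}^∞ (λ^i/i!) Σ_{k=0}^i C(i,k) (−1)^k (∂_x^{i−k}∂_p^k f)·(∂_x^k ∂_p^{i−k} g).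
   On polynomials only finitely many terms are nonzero, so the `finsum` below is faithful. -/

open MvPolynomial

/-- Differentiation with respect to x (the variable `X 0`). -/
noncomputable def dX : MvPolynomial (Fin 2) ℝ → MvPolynomial (Fin 2) ℝ :=
  fun f => pderiv (0 : Fin 2) f

/-- Differentiation with respect to p (the variable `X 1`). -/
noncomputable def dP : MvPolynomial (Fin 2) ℝ → MvPolynomial (Fin 2) ℝ :=
  fun f => pderiv (1 : Fin 2) f

/-- The Moyal star product with deformation parameter `lam`. -/
noncomputable def moyal (lam : ℝ) (f g : MvPolynomial (Fin 2) ℝ) : MvPolynomial (Fin 2) ℝ :=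
  ∑ᶠ i : ℕ, (lam ^ i / (i.factorial : ℝ)) •
    ∑ k ∈ Finset.range (i + 1),
      ((i.choose k : ℝ) * (-1 : ℝ) ^ k) • (dX^[i - k] (dP^[k] f) * dX^[k] (dP^[i - k] g))

/-- The inclusion of polynomials in the single variable p into ℝ[x,p]. -/
noncomputable def toMv (q : Polynomial ℝ) : MvPolynomial (Fin 2) ℝ :=
  Polynomial.aeval (X 1 : MvPolynomial (Fin 2) ℝ) q

/-- The left ideal J_l = ℝ[x,p] *_λ x^n. -/
def Jl (lam : ℝ) (n : ℕ) : Set (MvPolynomial (Fin 2) ℝ) :=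
  {f | ∃ g : MvPolynomial (Fin 2) ℝ, f = moyal lam g (X 0 ^ n)}

/-- The operator `f ↦ x f + c ∂f/∂p` on `ℝ[x,p]`. -/
noncomputable def shiftOp (c : ℝ) : Module.End ℝ (MvPolynomial (Fin 2) ℝ) :=
  LinearMap.mulLeft ℝ (X 0) + c • (pderiv (1 : Fin 2)).toLinearMap

theorem commute_mulLeft_pderiv :
    Commute (LinearMap.mulLeft ℝ (X 0 : MvPolynomial (Fin 2) ℝ))
      (pderiv (1 : Fin 2)).toLinearMap := by
  refine LinearMap.ext fun f => ?_
  simp [Derivation.leibniz]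

theorem pderiv_pow_apply (i : ℕ) (f : MvPolynomial (Fin 2) ℝ) :
    ((pderiv (1 : Fin 2)).toLinearMap ^ i) f = dP^[i] f := by
  rw [Module.End.pow_apply]
  rfl

theorem shiftOp_pow_apply (c : ℝ) (n : ℕ) (f : MvPolynomial (Fin 2) ℝ) :
    (shiftOp c ^ n) f =
      ∑ i ∈ Finset.range (n + 1), (c ^ i * (n.choose i : ℝ)) • (dP^[i] f * X 0 ^ (n - i)) := by
  rw [shiftOp, add_comm, (commute_mulLeft_pderiv.symm.smul_left c).add_pow, LinearMap.sum_apply]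
  refine Finset.sum_congr rfl fun i _ => ?_
  rw [((commute_mulLeft_pderiv.symm.smul_left c).pow_pow i (n - i)).eq, ← nsmul_eq_mul',
    LinearMap.smul_apply, smul_pow, Module.End.mul_apply, LinearMap.smul_apply,
    pderiv_pow_apply, LinearMap.pow_mulLeft, LinearMap.mulLeft_apply, mul_smul_comm,
    ← Nat.cast_smul_eq_nsmul ℝ, smul_smul, mul_comm (X 0 ^ (n - i)), mul_comm (c ^ i)]

theorem dX_iterate_X_pow (n i : ℕ) :
    dX^[i] (X 0 ^ n) = (n.descFactorial i : ℝ) • X 0 ^ (n - i) := by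
  induction i with
  | zero => simp
  | succ i ih =>
    rw [Function.iterate_succ_apply', ih, dX, Derivation.map_smul, Derivation.leibniz_pow,
      pderiv_X_self, Nat.descFactorial_succ, smul_eq_mul, mul_one, ← Nat.cast_smul_eq_nsmul ℝ,
      smul_smul, Nat.sub_sub, ← Nat.cast_mul, mul_comm]

theorem dX_iterate_zero (i : ℕ) : dX^[i] 0 = 0 :=
  Function.iterate_fixed (by simp [dX]) i

theorem dP_iterate_X_pow (n : ℕ) {i : ℕ} (hi : i ≠ 0) : dP^[i] (X 0 ^ n) = 0 := by
  obtain ⟨i, rfl⟩ := Nat.exists_eq_succ_of_ne_zero hi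
  rw [Function.iterate_succ_apply]
  have h0 : dP (X 0 ^ n) = 0 := by simp [dP, Derivation.leibniz_pow]
  rw [h0]
  exact Function.iterate_fixed (by simp [dP]) i

theorem finsum_descFactorial (c : ℝ) (n : ℕ) (f : MvPolynomial (Fin 2) ℝ) :
    ∑ᶠ i : ℕ, (c ^ i / (i.factorial : ℝ)) • (dP^[i] f * dX^[i] (X 0 ^ n)) =
      (shiftOp c ^ n) f := by
  rw [shiftOp_pow_apply, finsum_eq_sum_of_support_subset (s := Finset.range (n + 1))]
  · refine Finset.sum_congr rfl fun i _ => ?_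
    rw [dX_iterate_X_pow, mul_smul_comm, smul_smul, Nat.descFactorial_eq_factorial_mul_choose]
    congr 1
    push_cast
    field_simp
  · intro i hi
    by_contra hlt
    have hlt' : n < i := by simpa [Nat.lt_succ_iff] using hlt
    refine hi ?_
    simp [dX_iterate_X_pow, Nat.descFactorial_of_lt hlt']

theorem moyal_X_pow_right (lam : ℝ) (n : ℕ) (f : MvPolynomial (Fin 2) ℝ) :
    moyal lam f (X 0 ^ n) = (shiftOp (-lam) ^ n) f := by
  rw [← finsum_descFactorial, moyal]
  refine finsum_congr fun i => ?_
  rw [Finset.sum_eq_single_of_mem i (by simp)]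
  · simp only [Nat.sub_self, Function.iterate_zero, id, Nat.choose_self, Nat.cast_one, one_mul,
      smul_smul]
    congr 1
    rw [neg_pow]
    ring
  · intro k hk hki
    have hsub : i - k ≠ 0 := by
      have := Finset.mem_range.mp hk
      omega
    simp [dP_iterate_X_pow n hsub, dX_iterate_zero]

theorem moyal_X_pow_left (lam : ℝ) (n : ℕ) (f : MvPolynomial (Fin 2) ℝ) :
    moyal lam (X 0 ^ n) f = (shiftOp lam ^ n) f := by
  rw [← finsum_descFactorial, moyal]
  refine finsum_congr fun i => ?_
  rw [Finset.sum_eq_single_of_mem 0 (by simp)]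
  · simp [mul_comm]
  · intro k _ hk
    simp [dP_iterate_X_pow n hk, dX_iterate_zero]

theorem commute_shiftOp_pderiv (c : ℝ) :
    Commute (shiftOp c) (pderiv (1 : Fin 2)).toLinearMap :=
  commute_mulLeft_pderiv.add_left ((Commute.refl _).smul_left c)

theorem shiftOp_eq_add (lam : ℝ) :
    shiftOp lam = shiftOp (-lam) + (2 * lam) • (pderiv (1 : Fin 2)).toLinearMap := by
  rw [shiftOp, shiftOp, add_assoc, ← add_smul]
  congr 2
  ring

theorem dP_toMv (q : Polynomial ℝ) : dP (toMv q) = toMv (Polynomial.derivative q) := by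
  simp [dP, toMv, Derivation.map_aeval]

theorem dP_iterate_toMv (i : ℕ) (q : Polynomial ℝ) :
    dP^[i] (toMv q) = toMv (Polynomial.derivative^[i] q) :=
  ((Function.Semiconj.iterate_right (f := toMv) (fun q => (dP_toMv q).symm) i) q).symm

theorem toMv_smul (c : ℝ) (q : Polynomial ℝ) : toMv (c • q) = c • toMv q :=
  map_smul _ _ _

theorem toMv_sum {ι : Type*} (s : Finset ι) (q : ι → Polynomial ℝ) :
    toMv (∑ i ∈ s, q i) = ∑ i ∈ s, toMv (q i) :=
  map_sum _ _ _

/-- Normal ordering of `x^n *_λ (q *_λ x^i)`. -/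
theorem shiftOp_pow_shiftOp_neg_pow (lam : ℝ) (n i : ℕ) (q : Polynomial ℝ) :
    (shiftOp lam ^ n) ((shiftOp (-lam) ^ i) (toMv q)) =
      ∑ m ∈ Finset.range (n + 1), (shiftOp (-lam) ^ (i + m))
        (toMv (((n.choose m : ℝ) * (2 * lam) ^ (n - m)) • Polynomial.derivative^[n - m] q)) := by
  have hc := (commute_shiftOp_pderiv (-lam)).smul_right (2 * lam)
  rw [shiftOp_eq_add, hc.add_pow, LinearMap.sum_apply]
  refine Finset.sum_congr rfl fun m _ => ?_
  rw [← nsmul_eq_mul', LinearMap.smul_apply, ← Module.End.mul_apply, mul_assoc,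
    ← (hc.pow_pow i (n - m)).eq, ← mul_assoc, ← pow_add, Module.End.mul_apply, smul_pow,
    LinearMap.smul_apply, pderiv_pow_apply, dP_iterate_toMv, toMv_smul, ← map_nsmul,
    ← Nat.cast_smul_eq_nsmul ℝ, smul_smul, add_comm m]

theorem exists_normal_ordering (lam : ℝ) (n : ℕ) (h : ℕ → Polynomial ℝ) :
    ∃ g, moyal lam (X 0 ^ n) (∑ i ∈ Finset.range n, moyal lam (toMv (h i)) (X 0 ^ i)) =
      (∑ l ∈ Finset.range n, (shiftOp (-lam) ^ l) (toMv (∑ i ∈ Finset.range (l + 1),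
          ((n.choose (l - i) : ℝ) * (2 * lam) ^ (n - l + i)) •
            (⇑Polynomial.derivative)^[n - l + i] (h i)))) + (shiftOp (-lam) ^ n) g := by
  let F : ℕ → ℕ → MvPolynomial (Fin 2) ℝ := fun i m =>
    toMv (((n.choose m : ℝ) * (2 * lam) ^ (n - m)) • Polynomial.derivative^[n - m] (h i))
  refine ⟨∑ i ∈ Finset.range n, ∑ k ∈ Finset.range (i + 1),
    (shiftOp (-lam) ^ k) (F i (n - i + k)), ?_⟩
  have hlow : ∀ l ∈ Finset.range n,
      (shiftOp (-lam) ^ l) (toMv (∑ i ∈ Finset.range (l + 1),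
          ((n.choose (l - i) : ℝ) * (2 * lam) ^ (n - l + i)) •
            (⇑Polynomial.derivative)^[n - l + i] (h i))) =
        ∑ i ∈ Finset.range (l + 1), (shiftOp (-lam) ^ (i + (l - i))) (F i (l - i)) := by
    intro l hl
    rw [toMv_sum, map_sum]
    refine Finset.sum_congr rfl fun i hi => ?_
    rw [Finset.mem_range] at hl hi
    have hil : i + (l - i) = l := by omega
    have hnl : n - l + i = n - (l - i) := by omega
    rw [hil, hnl]
  rw [Finset.sum_congr rfl hlow,
    Finset.sum_range_diag_flip n fun i m => (shiftOp (-lam) ^ (i + m)) (F i m),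
    moyal_X_pow_left, map_sum, map_sum, ← Finset.sum_add_distrib]
  refine Finset.sum_congr rfl fun i hi => ?_
  have hn : n + 1 = n - i + (i + 1) := by
    have := Finset.mem_range.mp hi
    omega
  rw [moyal_X_pow_right, shiftOp_pow_shiftOp_neg_pow, hn, Finset.sum_range_add, map_sum]
  congr 1
  refine Finset.sum_congr rfl fun k _ => ?_
  have hik : i + (n - i + k) = n + k := by omega
  rw [← Module.End.mul_apply, ← pow_add, hik]

section LeadingCoefficient

variable {A : Type*} [CommRing A] [Algebra ℝ A] {S : Module.End ℝ (Polynomial A)} {d : A → A}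

theorem coeff_pow_apply (hd : d 0 = 0)
    (hS : ∀ f k, (S f).coeff (k + 1) = f.coeff k + d (f.coeff (k + 1))) {f : Polynomial A} {m : ℕ}
    (hf : ∀ k, m < k → f.coeff k = 0) (j : ℕ) :
    ((S ^ j) f).coeff (m + j) = f.coeff m ∧ ∀ k, m + j < k → ((S ^ j) f).coeff k = 0 := by
  induction j with
  | zero => exact ⟨by simp, by simpa using hf⟩
  | succ j ih =>
    rw [pow_succ', Module.End.mul_apply]
    refine ⟨?_, fun k hk => ?_⟩
    · rw [← add_assoc, hS, ih.1, ih.2 _ (by omega), hd, add_zero]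
    · obtain ⟨k, rfl⟩ := Nat.exists_eq_succ_of_ne_zero (by omega : k ≠ 0)
      rw [Nat.succ_eq_add_one, hS, ih.2 _ (by omega), ih.2 _ (by omega), hd, add_zero]

/-- The expansion in powers of `S` with coefficients in `A` is unique modulo the range of
`S ^ n`. -/
theorem eq_zero_of_sum_pow_apply_C_eq (hd : d 0 = 0)
    (hS : ∀ f k, (S f).coeff (k + 1) = f.coeff k + d (f.coeff (k + 1))) (q : ℕ → A) (n : ℕ)
    (g : Polynomial A) (h : ∑ l ∈ Finset.range n, (S ^ l) (Polynomial.C (q l)) = (S ^ n) g) :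
    g = 0 ∧ ∀ l ∈ Finset.range n, q l = 0 := by
  induction n generalizing g with
  | zero => exact ⟨by simpa using h.symm, by simp⟩
  | succ n ih =>
    have hg : g = 0 := by
      rw [← Polynomial.leadingCoeff_eq_zero, Polynomial.leadingCoeff,
        ← (coeff_pow_apply hd hS (fun _ => Polynomial.coeff_eq_zero_of_natDegree_lt) (n + 1)).1,
        ← h, Polynomial.finsetSum_coeff]
      refine Finset.sum_eq_zero fun l hl => ?_
      refine (coeff_pow_apply (m := 0) hd hS (fun k hk => ?_) l).2 _ ?_
      · exact Polynomial.coeff_C_of_ne_zero hk.ne'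
      · have := Finset.mem_range.mp hl
        omega
    refine ⟨hg, ?_⟩
    rw [hg, map_zero, Finset.sum_range_succ] at h
    obtain ⟨hq, hlow⟩ := ih (-Polynomial.C (q n)) (by rw [map_neg, eq_neg_of_add_eq_zero_left h])
    intro l hl
    rcases Finset.mem_range_succ_iff.mp hl |>.lt_or_eq with hlt | rfl
    · exact hlow l (Finset.mem_range.mpr hlt)
    · simpa using hq

end LeadingCoefficient

/-- The identification of `ℝ[x,p]` with `ℝ[p][x]`. -/
noncomputable def toIterated : MvPolynomial (Fin 2) ℝ →ₐ[ℝ] Polynomial (Polynomial ℝ) :=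
  aeval ![Polynomial.X, Polynomial.C Polynomial.X]

theorem toIterated_toMv (q : Polynomial ℝ) : toIterated (toMv q) = Polynomial.C q := by
  have h : toIterated.comp (Polynomial.aeval (X 1)) =
      (Algebra.ofId (Polynomial ℝ) (Polynomial (Polynomial ℝ))).restrictScalars ℝ := by
    ext
    simp [toIterated, Algebra.ofId_apply]
  exact DFunLike.congr_fun h q

/-- The derivation of `ℝ[p][x]` differentiating each coefficient with respect to `p`. -/
noncomputable def coeffDerivation :
    Derivation ℝ (Polynomial (Polynomial ℝ)) (Polynomial (Polynomial ℝ)) :=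
  PolynomialModule.equivPolynomialSelf.compDer (Polynomial.derivative' (R := ℝ)).mapCoeffs

theorem coeff_coeffDerivation (f : Polynomial (Polynomial ℝ)) (k : ℕ) :
    (coeffDerivation f).coeff k = Polynomial.derivative (f.coeff k) :=
  rfl

/-- The operator corresponding to `shiftOp c` on `ℝ[p][x]`. -/
noncomputable def iteratedShiftOp (c : ℝ) : Module.End ℝ (Polynomial (Polynomial ℝ)) :=
  LinearMap.mulLeft ℝ Polynomial.X + c • coeffDerivation.toLinearMap

theorem coeffDerivation_toIterated_X (i : Fin 2) :
    coeffDerivation (toIterated (X i)) = toIterated (pderiv 1 (X i)) := by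
  ext1 k
  fin_cases i
  · simp [toIterated, coeff_coeffDerivation, Polynomial.coeff_X, apply_ite]
  · simp [toIterated, coeff_coeffDerivation, Polynomial.coeff_C, Polynomial.coeff_one, apply_ite]

theorem toIterated_pderiv (f : MvPolynomial (Fin 2) ℝ) :
    toIterated (pderiv 1 f) = coeffDerivation (toIterated f) := by
  induction f using MvPolynomial.induction_on with
  | C a => rw [← algebraMap_eq, AlgHom.commutes, Derivation.map_algebraMap,
      Derivation.map_algebraMap, map_zero]
  | add f g hf hg => simp only [map_add, hf, hg]
  | mul_X f i hf =>
    simp only [Derivation.leibniz, map_mul, map_add, smul_eq_mul, hf,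
      coeffDerivation_toIterated_X]

theorem toIterated_shiftOp_pow (c : ℝ) (n : ℕ) (f : MvPolynomial (Fin 2) ℝ) :
    toIterated ((shiftOp c ^ n) f) = (iteratedShiftOp c ^ n) (toIterated f) := by
  induction n with
  | zero => simp
  | succ n ih =>
    rw [pow_succ', pow_succ', Module.End.mul_apply, Module.End.mul_apply, ← ih]
    have hX : toIterated (X 0) = Polynomial.X := by simp [toIterated]
    generalize (shiftOp c ^ n) f = g
    simp [shiftOp, iteratedShiftOp, toIterated_pderiv, hX]

theorem coeff_iteratedShiftOp (c : ℝ) (f : Polynomial (Polynomial ℝ)) (k : ℕ) :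
    (iteratedShiftOp c f).coeff (k + 1) =
      f.coeff k + c • Polynomial.derivative (f.coeff (k + 1)) := by
  simp [iteratedShiftOp, coeff_coeffDerivation]

/-- normalizer criterion for the n-tuple point: for
h = Σ_{i=0}^{n−1} h_i *_λ x^i with the h_i polynomials in p alone, one has
x^n *_λ h ∈ J_l if and only if
Σ_{i=0}^{l} C(n, l−i) (2λ)^{n−l+i} d^{n−l+i}h_i/dp^{n−l+i} = 0 for every l = 0,…,n−1. -/
theorem normalizer_criterion (lam : ℝ) (hlam : lam ≠ 0) (n : ℕ) (hn : 1 ≤ n)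
    (h : ℕ → Polynomial ℝ) :
    moyal lam (X 0 ^ n) (∑ i ∈ Finset.range n, moyal lam (toMv (h i)) (X 0 ^ i)) ∈ Jl lam n ↔
      ∀ l ∈ Finset.range n,
        ∑ i ∈ Finset.range (l + 1),
          ((n.choose (l - i) : ℝ) * (2 * lam) ^ (n - l + i)) •
            (⇑Polynomial.derivative)^[n - l + i] (h i) = 0 := by
  obtain ⟨g₀, hg₀⟩ := exists_normal_ordering lam n h
  rw [hg₀]
  constructor
  · rintro ⟨g, hg⟩
    rw [moyal_X_pow_right, ← eq_sub_iff_add_eq, ← map_sub] at hg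
    have key := congrArg toIterated hg
    rw [map_sum, toIterated_shiftOp_pow] at key
    simp only [toIterated_shiftOp_pow, toIterated_toMv] at key
    exact (eq_zero_of_sum_pow_apply_C_eq
      (d := fun a => -lam • Polynomial.derivative a) (by simp) (coeff_iteratedShiftOp (-lam)) _ n _ key).2
  · intro hq
    refine ⟨g₀, ?_⟩
    rw [moyal_X_pow_right, Finset.sum_eq_zero, zero_add]
    intro l hl
    rw [hq l hl, toMv, map_zero, map_zero]
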